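/- Let D_1, D_2, …, D_n be pairwise disjoint D_p-massive subsets of V and for each k let u_k be an inner potential for D_k, extended by 0 on V \ D_k. Then there exist characters χ_1, …, χ_n ∈ ∂_p(Γ) such that for each k, χ_k lies in the closure of i(D_k) in Sp(BD_p(Γ)), χ_k(u_k) = 1, and χ_k(u_j) = 0 for all j ≠ k. In particular the χ_k are pairwise distinct. -/

import Mathlib

open Filter Topology
open scoped ENNReal

namespace PHB

variable {V : Type*}

/-- A graph has bounded degree if there is a uniform finite bound on the
number of neighbors of each vertex. -/
def BoundedDegree (G : SimpleGraph V) : Prop :=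
  ∃ k : ℕ, ∀ x : V, (G.neighborSet x).Finite ∧ (G.neighborSet x).ncard ≤ k

/-- The `p`-Dirichlet sum of `f` over a set `S` of vertices:
`∑_{x ∈ S} ∑_{y ∈ N_x} |f y - f x| ^ p`, valued in `ℝ≥0∞`. -/
noncomputable def IpOn (G : SimpleGraph V) (p : ℝ) (S : Set V) (f : V → ℝ) : ℝ≥0∞ :=
  ∑' x : S, ∑' y : G.neighborSet (x : V), ENNReal.ofReal (|f (y : V) - f (x : V)| ^ p)

/-- The total `p`-Dirichlet sum `I_p(f, V)`. -/
noncomputable def Ip (G : SimpleGraph V) (p : ℝ) (f : V → ℝ) : ℝ≥0∞ :=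
  IpOn G p Set.univ f

/-- `D_p(Γ)`: real functions with finite `p`-Dirichlet sum. -/
def Dirichlet (G : SimpleGraph V) (p : ℝ) : Set (V → ℝ) :=
  {f | Ip G p f ≠ ∞}

/-- `ℓ^∞(Γ)`: bounded real functions on the vertices. -/
def BddFun : Set (V → ℝ) :=
  {f | ∃ C : ℝ, ∀ x, |f x| ≤ C}

/-- `BD_p(Γ) = D_p(Γ) ∩ ℓ^∞(Γ)`. -/
def BDp (G : SimpleGraph V) (p : ℝ) : Set (V → ℝ) :=
  Dirichlet G p ∩ BddFun

/-- The sup norm `‖f‖_∞`. -/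
noncomputable def supNorm [Nonempty V] (f : V → ℝ) : ℝ :=
  ⨆ x, |f x|

/-- The norm `‖f‖_{BD_p} = I_p(f,V)^{1/p} + ‖f‖_∞` on `BD_p(Γ)`. -/
noncomputable def BDpNorm [Nonempty V] (G : SimpleGraph V) (p : ℝ) (f : V → ℝ) : ℝ :=
  (Ip G p f).toReal ^ (1 / p) + supNorm f

/-- The norm `‖f‖_{D_p} = (I_p(f,V) + |f o|^p)^{1/p}` on `D_p(Γ)`, for a fixed vertex `o`. -/
noncomputable def DpNorm (G : SimpleGraph V) (p : ℝ) (o : V) (f : V → ℝ) : ℝ :=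
  ((Ip G p f).toReal + |f o| ^ p) ^ (1 / p)

/-- The `p`-Laplacian `Δ_p f (x) = ∑_{y ∈ N_x} |f y - f x|^{p-2} (f y - f x)`
(with the convention that a summand vanishes when `f y = f x`). -/
noncomputable def pLap (G : SimpleGraph V) (p : ℝ) (f : V → ℝ) (x : V) : ℝ :=
  ∑' y : G.neighborSet x, |f (y : V) - f x| ^ (p - 2) * (f (y : V) - f x)

/-- `BHD_p(Γ)`: bounded `p`-harmonic functions with finite `p`-Dirichlet sum. -/
def BHDp (G : SimpleGraph V) (p : ℝ) : Set (V → ℝ) :=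
  {f | f ∈ BDp G p ∧ ∀ x, pLap G p f x = 0}

/-- The outer boundary `∂S`: vertices outside `S` with a neighbor in `S`. -/
def outerBoundary (G : SimpleGraph V) (S : Set V) : Set V :=
  {x | x ∉ S ∧ ∃ y ∈ S, G.Adj x y}

/-- A set of vertices is connected if the induced subgraph is connected. -/
def ConnectedSubset (G : SimpleGraph V) (S : Set V) : Prop :=
  (G.induce S).Connected

/-- `C` is a connected component of `S`: a maximal connected subset of `S`. -/
def IsComponentOf (G : SimpleGraph V) (C S : Set V) : Prop :=
  C.Nonempty ∧ C ⊆ S ∧ ConnectedSubset G C ∧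
    ∀ C', C ⊆ C' → C' ⊆ S → ConnectedSubset G C' → C' = C

/-- `u` is an inner potential for `U`: a nonnegative member of `BD_p(Γ)` that is
`p`-harmonic on `U`, vanishes on `∂U`, and has supremum `1` over `U`. -/
def InnerPotential (G : SimpleGraph V) (p : ℝ) (U : Set V) (u : V → ℝ) : Prop :=
  u ∈ BDp G p ∧ (∀ x, 0 ≤ u x) ∧ (∀ x ∈ U, pLap G p u x = 0) ∧
    (∀ x ∈ outerBoundary G U, u x = 0) ∧ IsLUB (u '' U) 1

/-- A `D_p`-massive subset: an infinite connected set with nonempty outer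
boundary admitting an inner potential. -/
def DpMassive (G : SimpleGraph V) (p : ℝ) (U : Set V) : Prop :=
  U.Infinite ∧ ConnectedSubset G U ∧ (outerBoundary G U).Nonempty ∧
    ∃ u, InnerPotential G p U u

/-- A character of the Banach algebra `BD_p(Γ)`: a nonzero (equivalently,
unital) ring homomorphism `BD_p(Γ) → ℂ`. -/
structure PCharacter (G : SimpleGraph V) (p : ℝ) where
  toFun : {f : V → ℝ // f ∈ BDp G p} → ℂ
  map_add' : ∀ f g h : {f : V → ℝ // f ∈ BDp G p},
    (h : V → ℝ) = (f : V → ℝ) + (g : V → ℝ) → toFun h = toFun f + toFun g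
  map_mul' : ∀ f g h : {f : V → ℝ // f ∈ BDp G p},
    (h : V → ℝ) = (f : V → ℝ) * (g : V → ℝ) → toFun h = toFun f * toFun g
  map_one' : ∀ h : {f : V → ℝ // f ∈ BDp G p}, (h : V → ℝ) = 1 → toFun h = 1

/-- `Sp(BD_p(Γ))` carries the weak-* topology: the topology of pointwise
convergence on elements of `BD_p(Γ)`. -/
noncomputable instance (G : SimpleGraph V) (p : ℝ) : TopologicalSpace (PCharacter G p) :=
  TopologicalSpace.induced (fun χ => χ.toFun) inferInstance

/-- The evaluation map `i : V → Sp(BD_p(Γ))`, `(i x) f = f x`. -/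
def evalChar (G : SimpleGraph V) (p : ℝ) (x : V) : PCharacter G p where
  toFun f := ((f : V → ℝ) x : ℂ)
  map_add' f g h hh := by
    show ((h : V → ℝ) x : ℂ) = ((f : V → ℝ) x : ℂ) + ((g : V → ℝ) x : ℂ)
    rw [hh]; push_cast [Pi.add_apply]; ring
  map_mul' f g h hh := by
    show ((h : V → ℝ) x : ℂ) = ((f : V → ℝ) x : ℂ) * ((g : V → ℝ) x : ℂ)
    rw [hh]; push_cast [Pi.mul_apply]; ring
  map_one' h hh := by
    show ((h : V → ℝ) x : ℂ) = 1
    rw [hh]; simp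

/-- The closure of `C_c(Γ)` in `(D_p(Γ), ‖·‖_{D_p})`. -/
def CcClosure (G : SimpleGraph V) (p : ℝ) (o : V) : Set (V → ℝ) :=
  {f | f ∈ Dirichlet G p ∧ ∀ ε > 0, ∃ g : V → ℝ,
      (Function.support g).Finite ∧ DpNorm G p o (f - g) < ε}

/-- `B(C̄_c)`: the bounded elements of the `D_p`-closure of `C_c(Γ)`. -/
def BCc (G : SimpleGraph V) (p : ℝ) (o : V) : Set (V → ℝ) :=
  CcClosure G p o ∩ BddFun

/-- The `p`-Royden boundary `R_p(Γ) = Sp(BD_p(Γ)) \ i(V)`. -/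
def RoydenBoundary (G : SimpleGraph V) (p : ℝ) : Set (PCharacter G p) :=
  (Set.range (evalChar G p))ᶜ

/-- The `p`-harmonic boundary
`∂_p(Γ) = {χ ∈ R_p(Γ) : χ f = 0 for all f ∈ B(C̄_c)}`. -/
def pHarmonicBoundary (G : SimpleGraph V) (p : ℝ) (o : V) : Set (PCharacter G p) :=
  {χ | χ ∈ RoydenBoundary G p ∧ ∀ f : {f : V → ℝ // f ∈ BDp G p},
      (f : V → ℝ) ∈ BCc G p o → χ.toFun f = 0}

/-- One-sided infinite self-avoiding paths in the subgraph induced on `A`. -/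
def IsPathIn (G : SimpleGraph V) (A : Set V) (γ : ℕ → V) : Prop :=
  Function.Injective γ ∧ (∀ n, G.Adj (γ n) (γ (n + 1))) ∧ ∀ n, γ n ∈ A

/-- `P_A`: the family of one-sided infinite self-avoiding paths in `Γ_A`. -/
def pathsIn (G : SimpleGraph V) (A : Set V) : Set (ℕ → V) :=
  {γ | IsPathIn G A γ}

/-- The `p`-modulus `λ_p(Q)⁻¹` of a path family `Q`: the infimum of
`∑_{e ∈ E} ρ(e)^p` over all densities `ρ` with `∑_{e ∈ Ed(γ)} ρ(e) ≥ 1`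
for every `γ ∈ Q`.  `λ_p(Q) = ∞` corresponds to `pModulus Q = 0`. -/
noncomputable def pModulus (G : SimpleGraph V) (p : ℝ) (Q : Set (ℕ → V)) : ℝ≥0∞ :=
  ⨅ (ρ : Sym2 V → ℝ≥0∞)
    (_ : ∀ γ ∈ Q, 1 ≤ ∑' n : ℕ, ρ s(γ n, γ (n + 1))),
      ∑' e : G.edgeSet, ρ (e : Sym2 V) ^ p

/-- A property `P` holds for `p`-almost every path in `Q` if the family of
paths of `Q` failing `P` has infinite extremal length (zero `p`-modulus). -/
def AlmostEvery (G : SimpleGraph V) (p : ℝ) (Q : Set (ℕ → V)) (P : (ℕ → V) → Prop) : Prop :=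
  pModulus G p {γ ∈ Q | ¬ P γ} = 0

/-- `f(γ) = c` for `p`-almost every path `γ ∈ P_A`. -/
def AsympConst (G : SimpleGraph V) (p : ℝ) (A : Set V) (f : V → ℝ) (c : ℝ) : Prop :=
  AlmostEvery G p (pathsIn G A)
    (fun γ => Tendsto (fun n => f (γ n)) atTop (nhds c))

/-- A set has property AC if every function in `BHD_p(Γ)` is asymptotically
constant on it. -/
def PropertyAC (G : SimpleGraph V) (p : ℝ) (A : Set V) : Prop :=
  ∀ h ∈ BHDp G p, ∃ c : ℝ, AsympConst G p A h c

/-- The `p`-capacity `Cap_p(A, ∞, S)`: the infimum of `I_p(u, S)` over functions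
`u` that are finitely supported on `S ∪ ∂S` and equal to `1` on `A`. -/
noncomputable def pCapacity (G : SimpleGraph V) (p : ℝ) (A S : Set V) : ℝ≥0∞ :=
  ⨅ (u : V → ℝ)
    (_ : ((S ∪ outerBoundary G S) ∩ Function.support u).Finite ∧ ∀ x ∈ A, u x = 1),
      IpOn G p S u

/-- An infinite connected set `S` is `p`-hyperbolic if `Cap_p(A, ∞, S) > 0` for
some nonempty finite set `A`. -/
def pHyperbolic (G : SimpleGraph V) (p : ℝ) (S : Set V) : Prop :=
  S.Infinite ∧ ConnectedSubset G S ∧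
    ∃ A : Set V, A.Finite ∧ A.Nonempty ∧ 0 < pCapacity G p A S

end PHB

namespace PHB

variable {V : Type*}

section Darts

variable (G : SimpleGraph V)

/-- Ordered pairs of adjacent vertices. -/
abbrev OrientedEdge : Type _ := Σ x : V, G.neighborSet x

variable {G}

/-- The difference of `f` along an oriented edge. -/
def grad (f : V → ℝ) (e : OrientedEdge G) : ℝ := f (e.2 : V) - f e.1

/-- The oriented edge with its orientation reversed. -/
def reverseEdge : OrientedEdge G ≃ OrientedEdge G where
  toFun e := ⟨e.2, e.1, G.adj_symm e.2.2⟩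
  invFun e := ⟨e.2, e.1, G.adj_symm e.2.2⟩
  left_inv _ := rfl
  right_inv _ := rfl

theorem Ip_eq_tsum (p : ℝ) (f : V → ℝ) :
    Ip G p f = ∑' e : OrientedEdge G, ENNReal.ofReal (|grad f e| ^ p) := by
  rw [ENNReal.tsum_sigma', Ip, IpOn]
  exact tsum_univ fun x => ∑' y : G.neighborSet x, ENNReal.ofReal (|f (y : V) - f x| ^ p)

theorem summable_of_tsum_ofReal_ne_top {ι : Type*} {a : ι → ℝ} (ha : ∀ i, 0 ≤ a i)
    (h : ∑' i, ENNReal.ofReal (a i) ≠ ∞) : Summable a := by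
  simpa [ENNReal.toReal_ofReal (ha _)] using ENNReal.summable_toReal h

theorem Ip_ne_top_iff {p : ℝ} {f : V → ℝ} :
    Ip G p f ≠ ∞ ↔ Summable fun e : OrientedEdge G => |grad f e| ^ p := by
  rw [Ip_eq_tsum]
  refine ⟨summable_of_tsum_ofReal_ne_top fun e => by positivity, fun h => ?_⟩
  rw [← ENNReal.ofReal_tsum_of_nonneg (fun e => by positivity) h]
  exact ENNReal.ofReal_ne_top

theorem add_rpow_le_two_rpow_mul {p a b : ℝ} (hp : 0 ≤ p) (ha : 0 ≤ a) (hb : 0 ≤ b) :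
    (a + b) ^ p ≤ 2 ^ p * (a ^ p + b ^ p) := by
  have h : (a + b) ^ p ≤ (2 * max a b) ^ p := by
    refine Real.rpow_le_rpow (by positivity) ?_ hp
    linarith [le_max_left a b, le_max_right a b]
  refine h.trans ?_
  rw [Real.mul_rpow (by norm_num) (by positivity)]
  gcongr
  have := Real.rpow_nonneg ha p
  have := Real.rpow_nonneg hb p
  rcases max_choice a b with h | h <;> rw [h] <;> linarith

theorem summable_add_rpow {ι : Type*} {p : ℝ} (hp : 0 ≤ p) {a b : ι → ℝ} (ha : ∀ i, 0 ≤ a i)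
    (hb : ∀ i, 0 ≤ b i) (hsa : Summable fun i => a i ^ p) (hsb : Summable fun i => b i ^ p) :
    Summable fun i => (a i + b i) ^ p :=
  Summable.of_nonneg_of_le (fun i => Real.rpow_nonneg (add_nonneg (ha i) (hb i)) p)
    (fun i => add_rpow_le_two_rpow_mul hp (ha i) (hb i)) ((hsa.add hsb).mul_left _)

theorem finite_setOf_fst_mem (hfin : ∀ x, (G.neighborSet x).Finite) {S : Set V} (hS : S.Finite) :
    {e : OrientedEdge G | e.1 ∈ S}.Finite := by
  have (x : V) : Finite (G.neighborSet x) := hfin x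
  refine (hS.biUnion fun x _ => Set.finite_range (Sigma.mk (β := fun x => G.neighborSet x) x)).subset
    fun e he => ?_
  simp only [Set.mem_iUnion]
  exact ⟨e.1, he, e.2, rfl⟩

theorem finite_support_grad (hfin : ∀ x, (G.neighborSet x).Finite) {g : V → ℝ}
    (hg : (Function.support g).Finite) :
    (Function.support fun e : OrientedEdge G => grad g e).Finite := by
  have h := finite_setOf_fst_mem hfin hg
  refine (h.union (h.preimage (f := reverseEdge) reverseEdge.injective.injOn)).subset fun e he => ?_
  by_contra hne
  simp only [Set.mem_union, Set.mem_ofPred_eq, Set.mem_preimage, Function.mem_support, not_or,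
    not_not] at hne
  refine he ?_
  have h2 : g (e.2 : V) = 0 := hne.2
  simp [grad, hne.1, h2]

theorem Ip_ne_top_of_finite_support (hfin : ∀ x, (G.neighborSet x).Finite) {p : ℝ} (hp : 0 < p)
    {g : V → ℝ} (hg : (Function.support g).Finite) : Ip G p g ≠ ∞ := by
  rw [Ip_ne_top_iff]
  refine summable_of_hasFiniteSupport ((finite_support_grad hfin hg).subset fun e he h0 => he ?_)
  have h0 : grad g e = 0 := h0
  simp [h0, hp.ne']

theorem Ip_sub_ne_top {p : ℝ} (hp : 0 ≤ p) {f g : V → ℝ} (hf : Ip G p f ≠ ∞)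
    (hg : Ip G p g ≠ ∞) : Ip G p (f - g) ≠ ∞ := by
  rw [Ip_ne_top_iff] at *
  refine Summable.of_nonneg_of_le (fun e => by positivity) (fun e => ?_)
    (summable_add_rpow hp (fun e => abs_nonneg _) (fun e => abs_nonneg _) hf hg)
  refine Real.rpow_le_rpow (abs_nonneg _) ?_ hp
  have : grad (f - g) e = grad f e - grad g e := by simp only [grad, Pi.sub_apply]; ring
  rw [this]
  exact abs_sub _ _

end Darts

section Flux

variable {G : SimpleGraph V}

/-- The nonlinear flux `|∇u|^{p-2} ∇u` along an oriented edge. -/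
noncomputable def flux (p : ℝ) (u : V → ℝ) (e : OrientedEdge G) : ℝ :=
  |grad u e| ^ (p - 2) * grad u e

theorem abs_flux {p : ℝ} (hp : 1 < p) (u : V → ℝ) (e : OrientedEdge G) :
    |flux p u e| = |grad u e| ^ (p - 1) := by
  rw [flux, abs_mul, abs_of_nonneg (Real.rpow_nonneg (abs_nonneg _) _)]
  rcases eq_or_ne (grad u e) 0 with h | h
  · simp [h, Real.zero_rpow (sub_pos.2 hp).ne']
  · rw [← Real.rpow_add_one (abs_ne_zero.2 h)]
    ring_nf

theorem flux_reverseEdge (p : ℝ) (u : V → ℝ) (e : OrientedEdge G) :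
    flux p u (reverseEdge e) = -flux p u e := by
  have h : grad u (reverseEdge e) = -grad u e := by simp [grad, reverseEdge]
  rw [flux, flux, h, abs_neg]
  ring

theorem rpow_sub_one_mul_le {p a b : ℝ} (hp : 1 < p) (ha : 0 ≤ a) (hb : 0 ≤ b) :
    a ^ (p - 1) * b ≤ a ^ p + b ^ p := by
  have key : ∀ m : ℝ, 0 ≤ m → m ^ (p - 1) * m = m ^ p := fun m hm => by
    rw [← Real.rpow_add_one' hm (by linarith)]
    ring_nf
  have := Real.rpow_nonneg ha p
  have := Real.rpow_nonneg hb p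
  rcases le_total a b with h | h
  · have := mul_le_mul_of_nonneg_right (Real.rpow_le_rpow ha h (sub_pos.2 hp).le) hb
    rw [key b hb] at this
    linarith
  · have := mul_le_mul_of_nonneg_left h (Real.rpow_nonneg ha (p - 1))
    rw [key a ha] at this
    linarith

/-- Green's formula against a finitely supported function that vanishes off the set where `u`
is `p`-harmonic. -/
theorem tsum_flux_mul_grad_eq_zero (hfin : ∀ x, (G.neighborSet x).Finite) {p : ℝ}
    {u g : V → ℝ} (hg : (Function.support g).Finite)
    (hu : ∀ x, g x ≠ 0 → pLap G p u x = 0) :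
    ∑' e : OrientedEdge G, flux p u e * grad g e = 0 := by
  have hs : Summable fun e : OrientedEdge G => flux p u e * g e.1 :=
    summable_of_hasFiniteSupport ((finite_setOf_fst_mem hfin hg).subset fun e he =>
      right_ne_zero_of_mul he)
  have h0 : ∑' e : OrientedEdge G, flux p u e * g e.1 = 0 := by
    have (x : V) : Finite (G.neighborSet x) := hfin x
    rw [hs.tsum_sigma' fun x => Summable.of_finite]
    refine (tsum_congr fun x => ?_).trans tsum_zero
    change ∑' y : G.neighborSet x, flux p u ⟨x, y⟩ * g x = 0
    rw [tsum_mul_right]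
    by_cases hx : g x = 0
    · simp [hx]
    · have := hu x hx
      rw [pLap] at this
      simp only [flux, grad, this, zero_mul]
  have hrev (e : OrientedEdge G) :
      flux p u e * g (e.2 : V) = -(flux p u (reverseEdge e) * g (reverseEdge e).1) := by
    rw [flux_reverseEdge]
    simp [reverseEdge]
  have hs' : Summable fun e : OrientedEdge G => flux p u (reverseEdge e) * g (reverseEdge e).1 :=
    reverseEdge.summable_iff.2 hs
  have h0' : ∑' e : OrientedEdge G, flux p u (reverseEdge e) * g (reverseEdge e).1 = 0 :=
    (reverseEdge.tsum_eq fun e : OrientedEdge G => flux p u e * g e.1).trans h0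
  simp only [grad, mul_sub, hrev]
  rw [hs'.neg.tsum_sub hs, tsum_neg, h0, h0']
  simp

end Flux

section Approximation

variable {G : SimpleGraph V}

/-- `f` is a pointwise limit of finitely supported functions whose gradients are dominated by
a single `p`-summable function. -/
def DominatedLimit (G : SimpleGraph V) (p : ℝ) (f : V → ℝ) : Prop :=
  ∃ (g : ℕ → V → ℝ) (A : OrientedEdge G → ℝ), (∀ n, (Function.support (g n)).Finite) ∧
    (∀ x, Tendsto (fun n => g n x) atTop (𝓝 (f x))) ∧
    (Summable fun e => A e ^ p) ∧ ∀ n e, |grad (g n) e| ≤ A e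

theorem DominatedLimit.zero {p : ℝ} (hp : 0 < p) : DominatedLimit G p 0 :=
  ⟨fun _ => 0, fun _ => 0, by simp, by simp, by simp [Real.zero_rpow hp.ne'], by simp [grad]⟩

theorem DominatedLimit.abs_add_abs {p : ℝ} (hp : 0 ≤ p) {f₁ f₂ : V → ℝ}
    (h₁ : DominatedLimit G p f₁) (h₂ : DominatedLimit G p f₂) :
    DominatedLimit G p fun x => |f₁ x| + |f₂ x| := by
  obtain ⟨g₁, A₁, hs₁, ht₁, hA₁, hb₁⟩ := h₁
  obtain ⟨g₂, A₂, hs₂, ht₂, hA₂, hb₂⟩ := h₂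
  refine ⟨fun n x => |g₁ n x| + |g₂ n x|, fun e => A₁ e + A₂ e, fun n => ?_,
    fun x => (ht₁ x).abs.add (ht₂ x).abs,
    summable_add_rpow hp (fun e => (abs_nonneg _).trans (hb₁ 0 e))
      (fun e => (abs_nonneg _).trans (hb₂ 0 e)) hA₁ hA₂, fun n e => ?_⟩
  · refine ((hs₁ n).union (hs₂ n)).subset fun x hx => ?_
    by_contra h
    simp only [Set.mem_union, Function.mem_support, not_or, not_not] at h
    exact hx (by simp [h.1, h.2])
  · have e₁ := (abs_abs_sub_abs_le (g₁ n (e.2 : V)) (g₁ n e.1)).trans (hb₁ n e)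
    have e₂ := (abs_abs_sub_abs_le (g₂ n (e.2 : V)) (g₂ n e.1)).trans (hb₂ n e)
    simp only [grad]
    rw [abs_le] at *
    constructor <;> linarith [e₁.1, e₁.2, e₂.1, e₂.2]

theorem tendsto_zero_of_tendsto_rpow {p : ℝ} (hp : 0 < p) {a : ℕ → ℝ}
    (h : Tendsto (fun n => |a n| ^ p) atTop (𝓝 0)) : Tendsto a atTop (𝓝 0) := by
  have h' := h.rpow_const (p := p⁻¹) (Or.inr (inv_pos.2 hp).le)
  simp only [Real.rpow_rpow_inv (abs_nonneg _) hp.ne', Real.zero_rpow (inv_pos.2 hp).ne'] at h'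
  exact (tendsto_zero_iff_abs_tendsto_zero a).2 h'

theorem dominatedLimit_of_mem_CcClosure (hG : G.Connected)
    (hfin : ∀ x, (G.neighborSet x).Finite) {p : ℝ} (hp : 0 < p) {o : V} {f : V → ℝ}
    (hf : f ∈ CcClosure G p o) : DominatedLimit G p f := by
  obtain ⟨hfD, hf⟩ := hf
  have hfD : Ip G p f ≠ ∞ := hfD
  have hex (n : ℕ) : ∃ g : V → ℝ, (Function.support g).Finite ∧
      Ip G p (f - g) ≤ ENNReal.ofReal ((1 / 2) ^ n) ∧ |(f - g) o| ^ p ≤ (1 / 2) ^ n := by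
    obtain ⟨g, hg, hlt⟩ := hf (((1 / 2 : ℝ) ^ n) ^ (1 / p)) (by positivity)
    have hne := Ip_sub_ne_top hp.le hfD (Ip_ne_top_of_finite_support hfin hp hg)
    rw [DpNorm, Real.rpow_lt_rpow_iff (by positivity) (by positivity) (by positivity)] at hlt
    have h1 : 0 ≤ |(f - g) o| ^ p := by positivity
    have h2 : 0 ≤ (Ip G p (f - g)).toReal := ENNReal.toReal_nonneg
    exact ⟨g, hg, (ENNReal.le_ofReal_iff_toReal_le hne (by positivity)).2 (by linarith),
      by linarith⟩
  choose g hg hI ho using hex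
  have hpow : Tendsto (fun n : ℕ => (1 / 2 : ℝ) ^ n) atTop (𝓝 0) :=
    tendsto_pow_atTop_nhds_zero_of_lt_one (by norm_num) (by norm_num)
  have hedge (e : OrientedEdge G) (n : ℕ) : |grad (f - g n) e| ^ p ≤ (1 / 2) ^ n := by
    have h := (ENNReal.le_tsum e).trans ((Ip_eq_tsum (G := G) p (f - g n)).ge.trans (hI n))
    exact (ENNReal.ofReal_le_ofReal_iff (by positivity)).1 h
  have hlim (x : V) : Tendsto (fun n => (f - g n) x) atTop (𝓝 0) := by
    have hr := hG.preconnected o x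
    rw [SimpleGraph.reachable_iff_reflTransGen] at hr
    induction hr with
    | refl =>
      exact tendsto_zero_of_tendsto_rpow hp
        (squeeze_zero (fun n => by positivity) ho hpow)
    | @tail b c _ hbc ih =>
      have := ih.add (tendsto_zero_of_tendsto_rpow hp
        (squeeze_zero (fun n => by positivity) (hedge ⟨b, c, hbc⟩) hpow))
      simpa [grad] using this
  have hsum : ∑' e : OrientedEdge G, ∑' n, ENNReal.ofReal (|grad (f - g n) e| ^ p) ≠ ∞ := by
    rw [ENNReal.tsum_comm]
    refine ne_top_of_le_ne_top ?_ (ENNReal.tsum_le_tsum fun n =>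
      (Ip_eq_tsum (G := G) p (f - g n)).ge.trans (hI n))
    rw [← ENNReal.ofReal_tsum_of_nonneg (fun n => by positivity) summable_geometric_two]
    exact ENNReal.ofReal_ne_top
  have hsn (e : OrientedEdge G) : Summable fun n => |grad (f - g n) e| ^ p :=
    Summable.of_nonneg_of_le (fun n => by positivity) (hedge e) summable_geometric_two
  have hB0 (e : OrientedEdge G) : 0 ≤ ∑' n, |grad (f - g n) e| ^ p :=
    tsum_nonneg fun n => by positivity
  refine ⟨g, fun e => |grad f e| + (∑' n, |grad (f - g n) e| ^ p) ^ p⁻¹, hg, fun x => ?_, ?_, ?_⟩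
  · simpa using (tendsto_const_nhds (x := f x)).sub (hlim x)
  · refine summable_add_rpow hp.le (fun e => abs_nonneg _) (fun e => Real.rpow_nonneg (hB0 e) _)
      (Ip_ne_top_iff.1 hfD) ?_
    simp only [Real.rpow_inv_rpow (hB0 _) hp.ne']
    refine summable_of_tsum_ofReal_ne_top hB0 ?_
    have heq (e : OrientedEdge G) := ENNReal.ofReal_tsum_of_nonneg
      (fun n => Real.rpow_nonneg (abs_nonneg (grad (f - g n) e)) p) (hsn e)
    simpa only [heq] using hsum
  · intro n e
    have h1 : |grad (f - g n) e| ≤ (∑' n, |grad (f - g n) e| ^ p) ^ p⁻¹ := by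
      rw [Real.le_rpow_inv_iff_of_pos (abs_nonneg _) (hB0 e) hp]
      exact (hsn e).le_tsum n fun m _ => by positivity
    have h2 : grad (g n) e = grad f e - grad (f - g n) e := by
      simp only [grad, Pi.sub_apply]; ring
    rw [h2]
    exact (abs_sub _ _).trans (by linarith)

/-- The peak set of an inner potential is not covered by `{|f| ≥ ε}` when `f` is a dominated
limit of finitely supported functions. -/
theorem InnerPotential.exists_abs_lt (hG : G.Connected)
    (hfin : ∀ x, (G.neighborSet x).Finite) {p : ℝ} (hp : 1 < p) {U : Set V} {u : V → ℝ}
    (hU : (outerBoundary G U).Nonempty) (hu : InnerPotential G p U u)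
    (hu0 : ∀ x ∉ U, u x = 0) {f : V → ℝ} (hf : DominatedLimit G p f) {ε : ℝ} (hε : 0 < ε)
    (hε1 : ε < 1) : ∃ x, 1 - ε < u x ∧ |f x| < ε := by
  by_contra! hcon
  obtain ⟨⟨huD, -⟩, -, hharm, -, hlub⟩ := hu
  have huD : Ip G p u ≠ ∞ := huD
  rw [Ip_ne_top_iff] at huD
  obtain ⟨g, A, hgs, hgt, hA, hgA⟩ := hf
  have hA0 (e) : 0 ≤ A e := (abs_nonneg _).trans (hgA 0 e)
  have hu1 (x : V) : u x ≤ 1 := by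
    by_cases hx : x ∈ U
    · exact hlub.1 ⟨x, hx, rfl⟩
    · rw [hu0 x hx]; exact zero_le_one
  set v : V → ℝ := fun x => max (u x - (1 - ε)) 0 with hv
  have hv0 (x : V) (hx : x ∉ U) : v x = 0 := by
    simp only [hv, hu0 x hx]
    exact max_eq_right (by linarith)
  have hvf (x : V) : min (v x) |f x| = v x := by
    refine min_eq_left ?_
    by_cases hx : 1 - ε < u x
    · exact (max_le (by linarith [hu1 x]) hε.le).trans (hcon x hx)
    · exact (max_le (by linarith) le_rfl).trans (abs_nonneg _)
  have hvgrad (e : OrientedEdge G) : |grad v e| ≤ |grad u e| := by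
    have := abs_max_sub_max_le_abs (u (e.2 : V) - (1 - ε)) (u e.1 - (1 - ε)) 0
    simpa [grad, hv] using this
  let h : ℕ → V → ℝ := fun n x => min (v x) |g n x|
  have hhs (n : ℕ) : (Function.support (h n)).Finite := by
    refine (hgs n).subset fun x hx hgx => hx ?_
    have hgx : g n x = 0 := hgx
    simp [h, hgx, hv]
  have hhU (n : ℕ) (x : V) (hx : h n x ≠ 0) : x ∈ U := by
    by_contra hxU
    exact hx (by simp [h, hv0 x hxU])
  have hzero (n : ℕ) : ∑' e : OrientedEdge G, flux p u e * grad (h n) e = 0 :=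
    tsum_flux_mul_grad_eq_zero hfin (hhs n) fun x hx => hharm x (hhU n x hx)
  have hht (x : V) : Tendsto (fun n => h n x) atTop (𝓝 (v x)) := by
    have := (tendsto_const_nhds (x := v x)).min (hgt x).abs
    rwa [hvf] at this
  have hhgrad (n : ℕ) (e : OrientedEdge G) : |grad (h n) e| ≤ |grad u e| + A e := by
    have h1 := abs_min_sub_min_le_max (v (e.2 : V)) |g n (e.2 : V)| (v e.1) |g n e.1|
    refine h1.trans (max_le ?_ ?_)
    · exact (hvgrad e).trans (le_add_of_nonneg_right (hA0 e))
    · exact ((abs_abs_sub_abs_le _ _).trans (hgA n e)).trans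
        (le_add_of_nonneg_left (abs_nonneg _))
  have hbound : Summable fun e : OrientedEdge G => |flux p u e| * (|grad u e| + A e) := by
    have hs := huD.add (summable_add_rpow (zero_lt_one.trans hp).le
      (fun e => abs_nonneg (grad u e)) hA0 huD hA)
    refine Summable.of_nonneg_of_le
      (fun e => mul_nonneg (abs_nonneg _) (add_nonneg (abs_nonneg _) (hA0 e))) (fun e => ?_) hs
    rw [abs_flux hp]
    exact rpow_sub_one_mul_le hp (abs_nonneg _) (add_nonneg (abs_nonneg _) (hA0 e))
  have hlim := tendsto_tsum_of_dominated_convergence (𝓕 := atTop)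
    (f := fun n e => flux p u e * grad (h n) e) (g := fun e => flux p u e * grad v e) hbound
    (fun e => (((hht _).sub (hht _)).const_mul _))
    (Eventually.of_forall fun n e => by
      rw [Real.norm_eq_abs, abs_mul]
      exact mul_le_mul_of_nonneg_left (hhgrad n e) (abs_nonneg _))
  simp only [hzero] at hlim
  have htsum := tendsto_nhds_unique hlim tendsto_const_nhds
  have hsv : Summable fun e : OrientedEdge G => flux p u e * grad v e := by
    refine Summable.of_norm_bounded hbound fun e => ?_
    rw [Real.norm_eq_abs, abs_mul]
    exact mul_le_mul_of_nonneg_left ((hvgrad e).trans (le_add_of_nonneg_right (hA0 e)))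
      (abs_nonneg _)
  have hmono (e : OrientedEdge G) : 0 ≤ grad u e * grad v e := by
    simp only [grad, hv]
    rcases le_total (u e.1) (u (e.2 : V)) with hle | hle
    · exact mul_nonneg (sub_nonneg.2 hle) (sub_nonneg.2 (by gcongr))
    · exact mul_nonneg_of_nonpos_of_nonpos (sub_nonpos.2 hle) (sub_nonpos.2 (by gcongr))
  have hnonneg (e : OrientedEdge G) : 0 ≤ flux p u e * grad v e := by
    rw [flux, mul_assoc]
    exact mul_nonneg (by positivity) (hmono e)
  have hgv (e : OrientedEdge G) : grad v e = 0 := by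
    have h0 : flux p u e * grad v e = 0 :=
      congrFun ((hsv.hasSum_iff.2 htsum |> (hasSum_zero_iff_of_nonneg hnonneg).1)) e
    rcases mul_eq_zero.1 h0 with h1 | h1
    · have : |grad u e| = 0 := by
        have h2 := abs_flux hp u e
        rw [h1, abs_zero, eq_comm, Real.rpow_eq_zero (abs_nonneg _) (sub_pos.2 hp).ne'] at h2
        exact h2
      exact abs_eq_zero.1 (le_antisymm ((hvgrad e).trans this.le) (abs_nonneg _))
    · exact h1
  obtain ⟨b, hb, -⟩ := hU
  have hall (x : V) : v x = 0 := by
    have hr := hG.preconnected b x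
    rw [SimpleGraph.reachable_iff_reflTransGen] at hr
    induction hr with
    | refl => exact hv0 b hb
    | @tail c d _ hcd ih => exact (sub_eq_zero.1 (hgv ⟨c, d, hcd⟩)).trans ih
  obtain ⟨_, ⟨x, -, rfl⟩, hx, -⟩ := hlub.exists_between (show 1 - ε < 1 by linarith)
  have := (le_max_left (u x - (1 - ε)) 0).trans (hall x).le
  linarith

end Approximation

section Characters

variable {G : SimpleGraph V} {p : ℝ}

theorem tendsto_limUnder_ultrafilter (𝒰 : Ultrafilter V) {f : V → ℝ} (hf : f ∈ BddFun) :
    Tendsto f 𝒰 (𝓝 (limUnder (𝒰 : Filter V) f)) := by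
  obtain ⟨C, hC⟩ := hf
  obtain ⟨a, -, ha⟩ := (isCompact_Icc (a := -C) (b := C)).ultrafilter_le_nhds (𝒰.map f) (by
    rw [le_principal_iff]
    change f ⁻¹' Set.Icc (-C) C ∈ (𝒰 : Filter V)
    exact Filter.mem_of_superset univ_mem fun x _ => abs_le.1 (hC x))
  exact tendsto_nhds_limUnder ⟨a, ha⟩

/-- The character of `BD_p(Γ)` given by taking limits along an ultrafilter on the vertices. -/
noncomputable def ultrafilterChar (G : SimpleGraph V) (p : ℝ) (𝒰 : Ultrafilter V) :
    PCharacter G p where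
  toFun f := (limUnder (𝒰 : Filter V) (f : V → ℝ) : ℝ)
  map_add' f g h hh := by
    rw [hh, ← Complex.ofReal_add]
    exact congrArg _ ((tendsto_limUnder_ultrafilter 𝒰 f.2.2).add
      (tendsto_limUnder_ultrafilter 𝒰 g.2.2)).limUnder_eq
  map_mul' f g h hh := by
    rw [hh, ← Complex.ofReal_mul]
    exact congrArg _ ((tendsto_limUnder_ultrafilter 𝒰 f.2.2).mul
      (tendsto_limUnder_ultrafilter 𝒰 g.2.2)).limUnder_eq
  map_one' h hh := by
    rw [hh, ← Complex.ofReal_one]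
    exact congrArg _ (tendsto_const_nhds (x := (1 : ℝ))).limUnder_eq

theorem ultrafilterChar_apply {𝒰 : Ultrafilter V} {f : {f : V → ℝ // f ∈ BDp G p}} {c : ℝ}
    (h : Tendsto (f : V → ℝ) 𝒰 (𝓝 c)) : (ultrafilterChar G p 𝒰).toFun f = c :=
  congrArg Complex.ofReal h.limUnder_eq

theorem tendsto_evalChar (𝒰 : Ultrafilter V) :
    Tendsto (evalChar G p) 𝒰 (𝓝 (ultrafilterChar G p 𝒰)) := by
  rw [nhds_induced, tendsto_comap_iff, tendsto_pi_nhds]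
  exact fun f => (Complex.continuous_ofReal.tendsto _).comp
    (tendsto_limUnder_ultrafilter 𝒰 f.2.2)

theorem ultrafilterChar_mem_closure {𝒰 : Ultrafilter V} {U : Set V} (hU : U ∈ 𝒰) :
    ultrafilterChar G p 𝒰 ∈ closure (evalChar G p '' U) :=
  mem_closure_of_tendsto (tendsto_evalChar 𝒰)
    (Filter.mem_of_superset hU fun _ hx => Set.mem_image_of_mem _ hx)

theorem finite_support_single [DecidableEq V] (x : V) :
    (Function.support (Pi.single x (1 : ℝ) : V → ℝ)).Finite :=
  (Set.finite_singleton x).subset Pi.support_single_subset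

theorem mem_BCc_of_finite_support (hfin : ∀ x, (G.neighborSet x).Finite) (hp : 0 < p) (o : V)
    {g : V → ℝ} (hg : (Function.support g).Finite) : g ∈ BCc G p o := by
  refine ⟨⟨Ip_ne_top_of_finite_support hfin hp hg, fun ε hε => ⟨g, hg, ?_⟩⟩, ?_⟩
  · have h0 : Ip G p (0 : V → ℝ) = 0 := by simp [Ip_eq_tsum, grad, Real.zero_rpow hp.ne']
    rw [sub_self, DpNorm, h0]
    simpa [Real.zero_rpow hp.ne', Real.zero_rpow (inv_pos.2 hp).ne'] using hε
  · obtain ⟨C, hC⟩ := (hg.image fun x => |g x|).bddAbove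
    refine ⟨max C 0, fun x => ?_⟩
    by_cases hx : g x = 0
    · simp [hx]
    · exact (hC ⟨x, hx, rfl⟩).trans (le_max_left _ _)

theorem ultrafilterChar_mem_pHarmonicBoundary (hfin : ∀ x, (G.neighborSet x).Finite) (hp : 0 < p)
    {o : V} {𝒰 : Ultrafilter V} (h : ∀ f ∈ BCc G p o, Tendsto f 𝒰 (𝓝 0)) :
    ultrafilterChar G p 𝒰 ∈ pHarmonicBoundary G p o := by
  classical
  have hvanish (f : {f : V → ℝ // f ∈ BDp G p}) (hf : (f : V → ℝ) ∈ BCc G p o) :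
      (ultrafilterChar G p 𝒰).toFun f = 0 := by
    simpa using ultrafilterChar_apply (h f hf)
  refine ⟨?_, hvanish⟩
  rintro ⟨x, hx⟩
  have hδ := mem_BCc_of_finite_support hfin hp o (finite_support_single x)
  have h0 := hvanish ⟨Pi.single x 1, hδ.1.1, hδ.2⟩ hδ
  rw [← hx] at h0
  simp [evalChar] at h0

/-- Along some ultrafilter an inner potential tends to its supremum while every function in
`B(C̄_c)` tends to zero. -/
theorem InnerPotential.exists_ultrafilter (hG : G.Connected)
    (hfin : ∀ x, (G.neighborSet x).Finite) (hp : 1 < p) (o : V) {U : Set V} {u : V → ℝ}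
    (hU : (outerBoundary G U).Nonempty) (hu : InnerPotential G p U u)
    (hu0 : ∀ x ∉ U, u x = 0) :
    ∃ 𝒰 : Ultrafilter V, U ∈ 𝒰 ∧ Tendsto u 𝒰 (𝓝 1) ∧ ∀ f ∈ BCc G p o, Tendsto f 𝒰 (𝓝 0) := by
  have hp0 := zero_lt_one.trans hp
  have : Nonempty V := ⟨o⟩
  let ι := {f : V → ℝ // DominatedLimit G p f} × Set.Ioo (0 : ℝ) 1
  let S : ι → Set V := fun i => {x | 1 - i.2 < u x ∧ |i.1.1 x| < i.2}
  let half : Set.Ioo (0 : ℝ) 1 := ⟨1 / 2, by norm_num, by norm_num⟩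
  have : Nonempty ι := ⟨⟨⟨0, .zero hp0⟩, half⟩⟩
  have hdir : Directed (· ≥ ·) fun i => 𝓟 (S i) := by
    intro i j
    refine ⟨⟨⟨_, i.1.2.abs_add_abs hp0.le j.1.2⟩, min i.2 j.2⟩, ?_, ?_⟩ <;>
      refine principal_mono.2 fun x hx => ?_ <;>
      obtain ⟨h1, h2⟩ := hx <;>
      simp only [abs_of_nonneg (add_nonneg (abs_nonneg (i.1.1 x)) (abs_nonneg (j.1.1 x)))] at h2 <;>
      [have hm : ((min i.2 j.2 : Set.Ioo (0 : ℝ) 1) : ℝ) ≤ i.2 := min_le_left i.2 j.2;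
       have hm : ((min i.2 j.2 : Set.Ioo (0 : ℝ) 1) : ℝ) ≤ j.2 := min_le_right i.2 j.2] <;>
      constructor <;> linarith [abs_nonneg (i.1.1 x), abs_nonneg (j.1.1 x)]
  have hne : NeBot (⨅ i, 𝓟 (S i)) := by
    refine iInf_neBot_of_directed hdir fun i => principal_neBot_iff.2 ?_
    exact hu.exists_abs_lt hG hfin hp hU hu0 i.1.2 i.2.2.1 i.2.2.2
  have hmem (i : ι) : S i ∈ Ultrafilter.of (⨅ i, 𝓟 (S i)) :=
    Ultrafilter.of_le _ (mem_iInf_of_mem i (mem_principal_self _))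
  have hu1 (x : V) : u x ≤ 1 := by
    by_cases hx : x ∈ U
    · exact hu.2.2.2.2.1 ⟨x, hx, rfl⟩
    · rw [hu0 x hx]; exact zero_le_one
  have key (f : V → ℝ) (hf : DominatedLimit G p f) (ε : ℝ) (hε : 0 < ε) :
      ∀ᶠ x in Ultrafilter.of (⨅ i, 𝓟 (S i)), 1 - ε < u x ∧ |f x| < ε := by
    have hlt : min ε (1 / 2) < 1 := (min_le_right _ _).trans_lt (by norm_num)
    filter_upwards [hmem ⟨⟨f, hf⟩, ⟨min ε (1 / 2), by positivity, hlt⟩⟩] with x hx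
    have hm := min_le_left ε (1 / 2)
    exact ⟨by linarith [hx.1], hx.2.trans_le hm⟩
  refine ⟨Ultrafilter.of (⨅ i, 𝓟 (S i)), ?_, ?_, fun f hf => ?_⟩
  · filter_upwards [key 0 (.zero hp0) 1 one_pos] with x hx
    by_contra hxU
    simp [hu0 x hxU] at hx
  · rw [Metric.tendsto_nhds]
    intro ε hε
    filter_upwards [key 0 (.zero hp0) ε hε] with x hx
    rw [Real.dist_eq, abs_lt]
    constructor <;> linarith [hx.1, hu1 x]
  · rw [Metric.tendsto_nhds]
    intro ε hε
    filter_upwards [key f (dominatedLimit_of_mem_CcClosure hG hfin hp0 hf.1) ε hε] with x hx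
    simpa using hx.2

end Characters

end PHB

open PHB Filter Topology

/-- Given pairwise disjoint `D_p`-massive sets `D_k` with inner potentials
`u_k` (extended by `0` off `D_k`), there are boundary characters
`χ_k ∈ closure(i(D_k)) ∩ ∂_p(Γ)` with `χ_k(u_k) = 1` and `χ_k(u_j) = 0` for
`j ≠ k`; in particular the `χ_k` are pairwise distinct. -/
theorem separating_boundary_characters {V : Type*} [Countable V] [Infinite V] (G : SimpleGraph V)
    (hG : G.Connected) (hdeg : BoundedDegree G) (p : ℝ) (hp : 1 < p)
    (o : V) (n : ℕ) (D : Fin n → Set V)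
    (hD : ∀ k, DpMassive G p (D k))
    (hdisj : Pairwise (Function.onFun Disjoint D))
    (u : Fin n → V → ℝ) (hu : ∀ k, InnerPotential G p (D k) (u k))
    (hu0 : ∀ k, ∀ x ∉ D k, u k x = 0) :
    ∃ χ : Fin n → PCharacter G p, Function.Injective χ ∧
      ∀ k, χ k ∈ pHarmonicBoundary G p o ∧
        χ k ∈ closure (evalChar G p '' D k) ∧
        (χ k).toFun ⟨u k, (hu k).1⟩ = 1 ∧
        ∀ j, j ≠ k → (χ k).toFun ⟨u j, (hu j).1⟩ = 0 := by
  obtain ⟨_, hk⟩ := hdeg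
  have hfin (x : V) : (G.neighborSet x).Finite := (hk x).1
  choose 𝒰 hmem hone hzero using fun k =>
    (hu k).exists_ultrafilter hG hfin hp o (hD k).2.2.1 (hu0 k)
  have hself (k : Fin n) : (ultrafilterChar G p (𝒰 k)).toFun ⟨u k, (hu k).1⟩ = 1 := by
    simpa using ultrafilterChar_apply (f := ⟨u k, (hu k).1⟩) (hone k)
  have hother (k j : Fin n) (hjk : j ≠ k) :
      (ultrafilterChar G p (𝒰 k)).toFun ⟨u j, (hu j).1⟩ = 0 := by
    have : Tendsto (u j) (𝒰 k) (𝓝 0) := by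
      refine tendsto_const_nhds.congr' ?_
      filter_upwards [hmem k] with x hx
      exact (hu0 j x fun hxj => Set.disjoint_left.1 (hdisj hjk) hxj hx).symm
    simpa using ultrafilterChar_apply (f := ⟨u j, (hu j).1⟩) this
  refine ⟨fun k => ultrafilterChar G p (𝒰 k), fun i j hij => ?_, fun k =>
    ⟨ultrafilterChar_mem_pHarmonicBoundary hfin (zero_lt_one.trans hp) (hzero k),
      ultrafilterChar_mem_closure (hmem k), hself k, hother k⟩⟩
  by_contra hne
  have h := hself i
  have hij : ultrafilterChar G p (𝒰 i) = ultrafilterChar G p (𝒰 j) := hij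
  rw [hij, hother j i hne] at h
  exact zero_ne_one h
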